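/- Let E be a pseudo-effect algebra and p ∈ E. Then: (i) if c is a central element of E, then p ∧ c exists in E and is a central element of the interval pseudo-effect algebra E[0,p]; (ii) the map c ↦ p ∧ c is a Boolean algebra homomorphism from Γ(E) into Γ(E[0,p]). -/

import Mathlib

namespace PEApaper

/-- The bare data of a partial-addition structure: a partial binary operation
(encoded via `Option`) together with constants `0` and `1`. -/
structure PartialStruct (E : Type) where
  padd : E → E → Option E
  zero : E
  one : E

namespace PartialStruct

variable {E : Type}

/-- `a ≤ b` iff `a + c = b` for some `c`. -/
def le (P : PartialStruct E) (a b : E) : Prop := ∃ c, P.padd a c = some b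

/-- `m` is the greatest lower bound (meet `a ∧ b`) of `a` and `b`. -/
def IsMeet (P : PartialStruct E) (a b m : E) : Prop :=
  P.le m a ∧ P.le m b ∧ ∀ x, P.le x a → P.le x b → P.le x m

/-- `j` is the least upper bound (join `a ∨ b`) of `a` and `b`. -/
def IsJoin (P : PartialStruct E) (a b j : E) : Prop :=
  P.le a j ∧ P.le b j ∧ ∀ x, P.le a x → P.le b x → P.le j x

/-- `s` is the supremum of the set `S`. -/
def IsSup (P : PartialStruct E) (S : Set E) (s : E) : Prop :=
  (∀ x ∈ S, P.le x s) ∧ ∀ u, (∀ x ∈ S, P.le x u) → P.le s u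

/-- Left-associated partial sum of a list, continuing from `acc`. -/
def IsSumFrom (P : PartialStruct E) : E → List E → E → Prop
  | acc, [], s => s = acc
  | acc, a :: l, s => ∃ t, P.padd acc a = some t ∧ IsSumFrom P t l s

/-- `s` is the (left-associated) orthosum `e₁ + e₂ + ⋯ + eₙ` of the list. -/
def IsSumList (P : PartialStruct E) (l : List E) (s : E) : Prop :=
  match l with
  | [] => s = P.zero
  | a :: t => IsSumFrom P a t s

/-- `c` is a central element: there is a PEA-isomorphism
`f : E → E[0,c] × E[0,c∼]` with `f c = (c,0)` such that `f x = (x₁,x₂)`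
implies `x = x₁ + x₂`.  The isomorphism onto the product of the two
interval pseudo-effect algebras is spelled out explicitly. -/
def IsCentral (P : PartialStruct E) (c : E) : Prop :=
  ∃ cs, P.padd c cs = some P.one ∧
    ∃ f : E → E × E,
      (∀ x, P.le (f x).1 c ∧ P.le (f x).2 cs) ∧
      Function.Injective f ∧
      (∀ y : E × E, P.le y.1 c → P.le y.2 cs → ∃ x, f x = y) ∧
      f c = (c, P.zero) ∧
      f P.one = (c, cs) ∧
      (∀ x, P.padd (f x).1 (f x).2 = some x) ∧
      (∀ a b ab, P.padd a b = some ab →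
        P.padd (f a).1 (f b).1 = some (f ab).1 ∧
        P.padd (f a).2 (f b).2 = some (f ab).2) ∧
      (∀ a b s t, P.padd (f a).1 (f b).1 = some s → P.le s c →
        P.padd (f a).2 (f b).2 = some t → P.le t cs →
        ∃ ab, P.padd a b = some ab)

/-- The center `Γ(E)`. -/
def center (P : PartialStruct E) : Set E := {c | P.IsCentral c}

/-- The central interval `Γ(E)[0,c] = Γ(E) ∩ E[0,c]`. -/
def centerIntervalSet (P : PartialStruct E) (c : E) : Set E :=
  {x | P.IsCentral x ∧ P.le x c}

/-- A Γ-orthogonal family: one dominated elementwise by a pairwise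
disjoint family of central elements. -/
def GammaOrthogonal (P : PartialStruct E) {I : Type} (e : I → E) : Prop :=
  ∃ c : I → E, (∀ i, P.IsCentral (c i)) ∧
    (∀ i j, i ≠ j → P.IsMeet (c i) (c j) P.zero) ∧
    ∀ i, P.le (e i) (c i)

/-- Centrally orthocomplete: every Γ-orthogonal family has a supremum. -/
def IsCOPEA (P : PartialStruct E) : Prop :=
  ∀ (I : Type) (e : I → E), P.GammaOrthogonal e → ∃ s, P.IsSup (Set.range e) s

/-- `c` is the central cover of `e`: the smallest central element above `e`. -/
def IsCentralCover (P : PartialStruct E) (c e : E) : Prop :=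
  P.IsCentral c ∧ P.le e c ∧ ∀ d, P.IsCentral d → P.le e d → P.le c d

/-- `[Q]`: the set of all suprema of Γ-orthogonal families of elements of `Q`. -/
def bra (P : PartialStruct E) (Q : Set E) : Set E :=
  {s | ∃ (I : Type) (e : I → E), (∀ i, e i ∈ Q) ∧ P.GammaOrthogonal e ∧
    P.IsSup (Set.range e) s}

/-- `Q^γ = {q ∧ c : q ∈ Q, c ∈ Γ(E)}`. -/
def gammaClosure (P : PartialStruct E) (Q : Set E) : Set E :=
  {m | ∃ q ∈ Q, ∃ c, P.IsCentral c ∧ P.IsMeet q c m}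

/-- `Q↓ = ⋃_{q ∈ Q} E[0,q]`. -/
def downSet (P : PartialStruct E) (Q : Set E) : Set E :=
  {e | ∃ q ∈ Q, P.le e q}

/-- `Q' = {e ∈ E : q ∧ e = 0 for all q ∈ Q}`. -/
def commutant (P : PartialStruct E) (Q : Set E) : Set E :=
  {e | ∀ q ∈ Q, P.IsMeet q e P.zero}

/-- A type-determining (TD) set: `K = [K] = K^γ`. -/
def IsTD (P : PartialStruct E) (K : Set E) : Prop :=
  P.bra K = K ∧ P.gammaClosure K = K

/-- A strongly type-determining (STD) set: `K = [K] = K↓`. -/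
def IsSTD (P : PartialStruct E) (K : Set E) : Prop :=
  P.bra K = K ∧ P.downSet K = K

/-- `c` is the type-cover of `K` (w.r.t. the central cover map `γ`):
the unique central element with `γK = Γ(E)[0,c]`. -/
def IsTypeCover (P : PartialStruct E) (γ : E → E) (K : Set E) (c : E) : Prop :=
  P.IsCentral c ∧ γ '' K = P.centerIntervalSet c

/-- An atom: a nonzero element with no proper nonzero subelement. -/
def IsAtom' (P : PartialStruct E) (a : E) : Prop :=
  a ≠ P.zero ∧ ∀ x, P.le x a → x = P.zero ∨ x = a

end PartialStruct

/-- A PEA-isomorphism between two partial-addition structures: a bijective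
morphism whose inverse is a morphism. -/
structure IsPEAIso {A B : Type} (P : PartialStruct A) (Q : PartialStruct B)
    (f : A → B) : Prop where
  bijective : Function.Bijective f
  map_one : f P.one = Q.one
  map_add : ∀ a b ab, P.padd a b = some ab → Q.padd (f a) (f b) = some (f ab)
  rev_add : ∀ a b s, Q.padd (f a) (f b) = some s → ∃ ab, P.padd a b = some ab

open scoped Classical in
/-- The (coordinatewise) product of a family of partial structures. -/
noncomputable def prodStruct {I : Type} {A : I → Type}
    (Ps : ∀ i, PartialStruct (A i)) : PartialStruct (∀ i, A i) where
  padd a b :=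
    if h : ∀ i, ∃ s, (Ps i).padd (a i) (b i) = some s
    then some fun i => Classical.choose (h i)
    else none
  zero := fun i => (Ps i).zero
  one := fun i => (Ps i).one

/-- A pseudo-effect algebra. -/
structure PEA (E : Type) extends PartialStruct E where
  assoc_def : ∀ a b c : E,
    (∃ ab, padd a b = some ab ∧ ∃ x, padd ab c = some x) ↔
    (∃ bc, padd b c = some bc ∧ ∃ y, padd a bc = some y)
  assoc_eq : ∀ a b c ab bc x y, padd a b = some ab → padd ab c = some x →
    padd b c = some bc → padd a bc = some y → x = y
  exu_right : ∀ a : E, ∃! d, padd a d = some one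
  exu_left : ∀ a : E, ∃! e, padd e a = some one
  shift : ∀ a b ab, padd a b = some ab →
    (∃ d, padd d a = some ab) ∧ (∃ e, padd b e = some ab)
  one_add : ∀ a x, padd one a = some x → a = zero
  add_one : ∀ a x, padd a one = some x → a = zero

namespace PEA

variable {E : Type} (P : PEA E)

/-- Shorthand for the underlying partial structure. -/
abbrev ps : PartialStruct E := P.toPartialStruct

theorem one_add_zero : P.padd P.one P.zero = some P.one := by
  obtain ⟨d, hd, -⟩ := P.exu_right P.one
  have h := P.one_add d P.one hd
  rwa [h] at hd

theorem zero_add_one : P.padd P.zero P.one = some P.one := by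
  obtain ⟨e, he, -⟩ := P.exu_left P.one
  have h := P.add_one e P.one he
  rwa [h] at he

theorem padd_zero (a : E) : P.padd a P.zero = some a := by
  obtain ⟨e, he, -⟩ := P.exu_left a
  have h1 : ∃ ab, P.padd e a = some ab ∧ ∃ x, P.padd ab P.zero = some x :=
    ⟨P.one, he, P.one, P.one_add_zero⟩
  obtain ⟨t, ht, y, hy⟩ := (P.assoc_def e a P.zero).mp h1
  have hxy : P.one = y :=
    P.assoc_eq e a P.zero P.one t P.one y he P.one_add_zero ht hy
  obtain ⟨d, hd, hu⟩ := P.exu_right e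
  have hta : t = a := by
    have h2 : t = d := hu t (by rw [← hxy] at hy; exact hy)
    have h3 : a = d := hu a he
    rw [h2, h3]
  rwa [hta] at ht

theorem zero_padd (a : E) : P.padd P.zero a = some a := by
  obtain ⟨d, hd, -⟩ := P.exu_right a
  have h1 : ∃ bc, P.padd a d = some bc ∧ ∃ y, P.padd P.zero bc = some y :=
    ⟨P.one, hd, P.one, P.zero_add_one⟩
  obtain ⟨t, ht, y, hy⟩ := (P.assoc_def P.zero a d).mpr h1
  have hxy : y = P.one :=
    P.assoc_eq P.zero a d t P.one y P.one ht hy hd P.zero_add_one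
  obtain ⟨e, he, hu⟩ := P.exu_left d
  have hta : t = a := by
    have h2 : t = e := hu t (by rw [hxy] at hy; exact hy)
    have h3 : a = e := hu a hd
    rw [h2, h3]
  rwa [hta] at ht

theorem zero_le (a : E) : P.ps.le P.zero a := ⟨a, P.zero_padd a⟩

theorem le_refl (a : E) : P.ps.le a a := ⟨P.zero, P.padd_zero a⟩

open scoped Classical in
/-- The interval pseudo-effect algebra `E[0,p]` as a partial structure on
the subtype `{x // x ≤ p}`; the sum is defined iff it is defined in `E`
and lies below `p`, and the unit is `p`. -/
noncomputable def intervalStruct (p : E) :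
    PartialStruct {x : E // P.ps.le x p} where
  padd a b := (P.padd a.1 b.1).bind fun s =>
    if h : P.ps.le s p then some ⟨s, h⟩ else none
  zero := ⟨P.zero, P.zero_le p⟩
  one := ⟨p, P.le_refl p⟩

end PEA

/-- The order relation of a complete Boolean algebra structure, made explicit. -/
def cbaLe {X : Type} (inst : CompleteBooleanAlgebra X) (a b : X) : Prop :=
  @LE.le X (by letI := inst; exact inferInstance) a b

end PEApaper

namespace PEApaper

namespace PEA

variable {E : Type} (P : PEA E)

theorem padd_left_cancel {a b b' s : E} (h : P.padd a b = some s)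
    (h' : P.padd a b' = some s) : b = b' := by
  obtain ⟨e, he, -⟩ := P.exu_left s
  obtain ⟨t, ht, x, hx⟩ := (P.assoc_def e a b).mpr ⟨s, h, P.one, he⟩
  obtain ⟨t', ht', x', hx'⟩ := (P.assoc_def e a b').mpr ⟨s, h', P.one, he⟩
  obtain rfl : t = t' := Option.some.inj (ht.symm.trans ht')
  obtain rfl := P.assoc_eq e a b t s x P.one ht hx h he
  obtain rfl := P.assoc_eq e a b' t s x' P.one ht hx' h' he
  exact (P.exu_right t).unique hx hx'

theorem eq_zero_of_padd_eq_self {a b : E} (h : P.padd a b = some a) : b = P.zero :=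
  P.padd_left_cancel h (P.padd_zero a)

theorem le_trans {a b c : E} (hab : P.ps.le a b) (hbc : P.ps.le b c) : P.ps.le a c := by
  obtain ⟨x, hx⟩ := hab
  obtain ⟨y, hy⟩ := hbc
  obtain ⟨t, ht, z, hz⟩ := (P.assoc_def a x y).mp ⟨b, hx, c, hy⟩
  obtain rfl := P.assoc_eq a x y b t c z hx hy ht hz
  exact ⟨t, hz⟩

theorem le_of_padd_right {a b s : E} (h : P.padd a b = some s) : P.ps.le b s :=
  (P.shift a b s h).2

theorem le_one (a : E) : P.ps.le a P.one :=
  (P.exu_right a).exists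

theorem eq_zero_of_padd_eq_zero {a b : E} (h : P.padd a b = some P.zero) : a = P.zero := by
  obtain ⟨t, ht, -⟩ := (P.assoc_def P.one a b).mpr ⟨P.zero, h, P.one, P.padd_zero P.one⟩
  exact P.one_add a t ht

theorem eq_zero_of_le_zero {a : E} (h : P.ps.le a P.zero) : a = P.zero :=
  let ⟨_, hb⟩ := h
  P.eq_zero_of_padd_eq_zero hb

theorem le_antisymm {a b : E} (hab : P.ps.le a b) (hba : P.ps.le b a) : a = b := by
  obtain ⟨x, hx⟩ := hab
  obtain ⟨y, hy⟩ := hba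
  obtain ⟨t, ht, z, hz⟩ := (P.assoc_def a x y).mp ⟨b, hx, a, hy⟩
  obtain rfl := P.assoc_eq a x y b t a z hx hy ht hz
  obtain rfl := P.eq_zero_of_padd_eq_self hz
  obtain rfl := P.eq_zero_of_padd_eq_zero ht
  exact Option.some.inj ((P.padd_zero a).symm.trans hx)

theorem isMeet_unique {a b m n : E} (hm : P.ps.IsMeet a b m) (hn : P.ps.IsMeet a b n) :
    m = n :=
  P.le_antisymm (hn.2.2 m hm.1 hm.2.1) (hm.2.2 n hn.1 hn.2.1)

theorem intervalStruct_padd {p : E} (a b s : {x : E // P.ps.le x p}) :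
    (P.intervalStruct p).padd a b = some s ↔ P.padd a.1 b.1 = some s.1 := by
  simp only [intervalStruct, Option.bind_eq_some_iff]
  constructor
  · rintro ⟨t, ht, h⟩
    split_ifs at h with hl
    rw [ht, ← Option.some.inj h]
  · intro h
    exact ⟨s.1, h, by simp [s.2]⟩

theorem intervalStruct_le {p : E} (a b : {x : E // P.ps.le x p}) :
    (P.intervalStruct p).le a b ↔ P.ps.le a.1 b.1 := by
  constructor
  · rintro ⟨c, hc⟩
    exact ⟨c.1, (P.intervalStruct_padd a c b).mp hc⟩
  · rintro ⟨c, hc⟩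
    exact ⟨⟨c, P.le_trans (P.le_of_padd_right hc) b.2⟩,
      (P.intervalStruct_padd a _ b).mpr hc⟩

/-- `f` is an isomorphism of `E` onto `E[0,c] × E[0,cs]` exhibiting `c` as a central
element with complement `cs`. -/
structure IsCentralDecomp (c cs : E) (f : E → E × E) : Prop where
  compl : P.padd c cs = some P.one
  fst_le : ∀ x, P.ps.le (f x).1 c
  snd_le : ∀ x, P.ps.le (f x).2 cs
  injective : Function.Injective f
  surj : ∀ a b, P.ps.le a c → P.ps.le b cs → ∃ x, f x = (a, b)
  map_self : f c = (c, P.zero)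
  map_one : f P.one = (c, cs)
  add_eq : ∀ x, P.padd (f x).1 (f x).2 = some x
  map_add : ∀ a b ab, P.padd a b = some ab →
    P.padd (f a).1 (f b).1 = some (f ab).1 ∧ P.padd (f a).2 (f b).2 = some (f ab).2
  rev_add : ∀ a b s t, P.padd (f a).1 (f b).1 = some s → P.ps.le s c →
    P.padd (f a).2 (f b).2 = some t → P.ps.le t cs → ∃ ab, P.padd a b = some ab

theorem exists_isCentralDecomp {c : E} (hc : P.ps.IsCentral c) :
    ∃ cs f, P.IsCentralDecomp c cs f := by
  obtain ⟨cs, h, f, h1, h2, h3, h4, h5, h6, h7, h8⟩ := hc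
  exact ⟨cs, f, h, fun x => (h1 x).1, fun x => (h1 x).2, h2,
    fun a b ha hb => h3 (a, b) ha hb, h4, h5, h6, h7, h8⟩

namespace IsCentralDecomp

variable {P} {c cs : E} {f : E → E × E}

theorem exists_padd (D : P.IsCentralDecomp c cs f) {x y a b : E}
    (h₁ : P.padd (f x).1 (f y).1 = some a) (ha : P.ps.le a c)
    (h₂ : P.padd (f x).2 (f y).2 = some b) (hb : P.ps.le b cs) :
    ∃ s, P.padd x y = some s ∧ f s = (a, b) := by
  obtain ⟨s, hs⟩ := D.rev_add x y a b h₁ ha h₂ hb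
  have h := D.map_add x y s hs
  exact ⟨s, hs, Prod.ext (Option.some.inj (h.1.symm.trans h₁))
    (Option.some.inj (h.2.symm.trans h₂))⟩

theorem le_iff (D : P.IsCentralDecomp c cs f) {x y : E} :
    P.ps.le x y ↔ P.ps.le (f x).1 (f y).1 ∧ P.ps.le (f x).2 (f y).2 := by
  constructor
  · rintro ⟨z, hz⟩
    exact ⟨⟨_, (D.map_add x z y hz).1⟩, ⟨_, (D.map_add x z y hz).2⟩⟩
  · rintro ⟨⟨u, hu⟩, ⟨v, hv⟩⟩
    obtain ⟨z, hz⟩ := D.surj u v (P.le_trans (P.le_of_padd_right hu) (D.fst_le y))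
      (P.le_trans (P.le_of_padd_right hv) (D.snd_le y))
    obtain ⟨s, hs, hfs⟩ := D.exists_padd (x := x) (y := z) (by rw [hz]; exact hu) (D.fst_le y)
      (by rw [hz]; exact hv) (D.snd_le y)
    obtain rfl : s = y := D.injective hfs
    exact ⟨z, hs⟩

theorem map_of_le (D : P.IsCentralDecomp c cs f) {x : E} (hx : P.ps.le x c) :
    f x = (x, P.zero) := by
  have h := (D.le_iff.mp hx).2
  rw [D.map_self] at h
  have h0 := P.eq_zero_of_le_zero h
  have hs := D.add_eq x
  rw [h0, P.padd_zero] at hs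
  exact Prod.ext (Option.some.inj hs) h0

theorem map_of_le_compl (D : P.IsCentralDecomp c cs f) {x : E} (hx : P.ps.le x cs) :
    f x = (P.zero, x) := by
  have hcs := (D.map_add c cs P.one D.compl).1
  rw [D.map_self, D.map_one] at hcs
  have h := (D.le_iff.mp hx).1
  rw [P.eq_zero_of_padd_eq_self hcs] at h
  have h0 := P.eq_zero_of_le_zero h
  have hs := D.add_eq x
  rw [h0, P.zero_padd] at hs
  exact Prod.ext h0 (Option.some.inj hs)

theorem le_fst (D : P.IsCentralDecomp c cs f) {x y : E} (hx : P.ps.le x c) (hxy : P.ps.le x y) :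
    P.ps.le x (f y).1 := by
  have h := (D.le_iff.mp hxy).1
  rwa [D.map_of_le hx] at h

theorem le_snd (D : P.IsCentralDecomp c cs f) {x y : E} (hx : P.ps.le x cs) (hxy : P.ps.le x y) :
    P.ps.le x (f y).2 := by
  have h := (D.le_iff.mp hxy).2
  rwa [D.map_of_le_compl hx] at h

theorem fst_le_self (D : P.IsCentralDecomp c cs f) (x : E) :
    P.ps.le (f x).1 x := ⟨_, D.add_eq x⟩

theorem snd_le_self (D : P.IsCentralDecomp c cs f) (x : E) : P.ps.le (f x).2 x :=
  P.le_of_padd_right (D.add_eq x)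

theorem isMeet_fst (D : P.IsCentralDecomp c cs f) (p : E) : P.ps.IsMeet p c (f p).1 :=
  ⟨D.fst_le_self p, D.fst_le p, fun _ hp hc => D.le_fst hc hp⟩

theorem isMeet_snd (D : P.IsCentralDecomp c cs f) (p : E) : P.ps.IsMeet p cs (f p).2 :=
  ⟨D.snd_le_self p, D.snd_le p, fun _ hp hc => D.le_snd hc hp⟩

theorem isCentral_interval (D : P.IsCentralDecomp c cs f) (p : E) :
    (P.intervalStruct p).IsCentral ⟨(f p).1, D.fst_le_self p⟩ := by
  refine ⟨⟨(f p).2, D.snd_le_self p⟩, (P.intervalStruct_padd _ _ _).mpr (D.add_eq p),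
    fun x => (⟨(f x.1).1, P.le_trans (D.fst_le_self x.1) x.2⟩,
      ⟨(f x.1).2, P.le_trans (D.snd_le_self x.1) x.2⟩),
    ?_, ?_, ?_, ?_, rfl, ?_, ?_, ?_⟩
  · intro x
    simp only [intervalStruct_le]
    exact D.le_iff.mp x.2
  · intro x y h
    simp only [Prod.mk.injEq, Subtype.mk.injEq] at h
    exact Subtype.ext (D.injective (Prod.ext h.1 h.2))
  · rintro ⟨⟨a, ha⟩, ⟨b, hb⟩⟩ h₁ h₂
    simp only [intervalStruct_le] at h₁ h₂
    obtain ⟨x, hx⟩ := D.surj a b (P.le_trans h₁ (D.fst_le p)) (P.le_trans h₂ (D.snd_le p))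
    exact ⟨⟨x, D.le_iff.mpr (by rw [hx]; exact ⟨h₁, h₂⟩)⟩, by simp [hx]⟩
  · simp only [D.map_of_le (D.fst_le p)]
    rfl
  · intro x
    exact (P.intervalStruct_padd _ _ _).mpr (D.add_eq x.1)
  · intro a b s h
    simp only [intervalStruct_padd] at h ⊢
    exact D.map_add _ _ _ h
  · intro a b s t h₁ hs h₂ ht
    simp only [intervalStruct_padd, intervalStruct_le] at h₁ hs h₂ ht
    obtain ⟨ab, hab, hf⟩ := D.exists_padd h₁ (P.le_trans hs (D.fst_le p)) h₂
      (P.le_trans ht (D.snd_le p))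
    exact ⟨⟨ab, D.le_iff.mpr (by rw [hf]; exact ⟨hs, ht⟩)⟩,
      (P.intervalStruct_padd _ _ _).mpr hab⟩

theorem snd_join_le (D : P.IsCentralDecomp c cs f) {d j : E} (hj : P.ps.IsJoin c d j) :
    P.ps.le (f j).2 d := by
  obtain ⟨z, hz⟩ := D.surj c (f d).2 (P.le_refl c) (D.snd_le d)
  have hjz : P.ps.le j z := hj.2.2 z
    (D.le_iff.mpr (by rw [hz, D.map_self]; exact ⟨P.le_refl c, P.zero_le _⟩))
    (D.le_iff.mpr (by rw [hz]; exact ⟨D.fst_le d, P.le_refl _⟩))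
  have h := (D.le_iff.mp hjz).2
  rw [hz] at h
  exact P.le_trans h (D.snd_le_self d)

/-- Meeting with `p` distributes over joins with a central element. -/
theorem isJoin_meet (D : P.IsCentralDecomp c cs f) {d j p mc md mj : E}
    (hj : P.ps.IsJoin c d j) (hmc : P.ps.IsMeet p c mc) (hmd : P.ps.IsMeet p d md)
    (hmj : P.ps.IsMeet p j mj) : P.ps.IsJoin mc md mj := by
  refine ⟨hmj.2.2 _ hmc.1 (P.le_trans hmc.2.1 hj.1),
    hmj.2.2 _ hmd.1 (P.le_trans hmd.2.1 hj.2.1), fun x hcx hdx => ?_⟩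
  refine D.le_iff.mpr ⟨D.le_fst (D.fst_le mj) ?_, D.le_snd (D.snd_le mj) ?_⟩
  · exact P.le_trans (hmc.2.2 _ (P.le_trans (D.fst_le_self mj) hmj.1) (D.fst_le mj)) hcx
  · exact P.le_trans (hmd.2.2 _ (P.le_trans (D.snd_le_self mj) hmj.1)
      (P.le_trans (D.le_iff.mp hmj.2.1).2 (D.snd_join_le hj))) hdx

end IsCentralDecomp

end PEA

end PEApaper

open PEApaper PEApaper.PartialStruct in
/-- Lemma 3.13: for `p ∈ E`:
(i) if `c` is central in `E`, then `p ∧ c` exists and is central in `E[0,p]`;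
(ii) the map `c ↦ p ∧ c` is a Boolean algebra homomorphism from `Γ(E)` into
`Γ(E[0,p])` (it preserves `0`, `1`, meets, joins, and complements). -/
theorem stmt5 {E : Type} (P : PEA E) (p : E) :
    (∀ c, P.ps.IsCentral c →
      ∃ (m : E) (hm : P.ps.le m p), P.ps.IsMeet p c m ∧
        (P.intervalStruct p).IsCentral ⟨m, hm⟩) ∧
    ((∀ m, P.ps.IsMeet p P.ps.zero m → m = P.ps.zero) ∧
     (∀ m, P.ps.IsMeet p P.ps.one m → m = p) ∧
     (∀ c d cd mc md mcd (hmc : P.ps.le mc p) (hmd : P.ps.le md p)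
        (hmcd : P.ps.le mcd p),
        P.ps.IsCentral c → P.ps.IsCentral d → P.ps.IsMeet c d cd →
        P.ps.IsMeet p c mc → P.ps.IsMeet p d md → P.ps.IsMeet p cd mcd →
        (P.intervalStruct p).IsMeet ⟨mc, hmc⟩ ⟨md, hmd⟩ ⟨mcd, hmcd⟩) ∧
     (∀ c d cd mc md mcd (hmc : P.ps.le mc p) (hmd : P.ps.le md p)
        (hmcd : P.ps.le mcd p),
        P.ps.IsCentral c → P.ps.IsCentral d → P.ps.IsJoin c d cd →
        P.ps.IsMeet p c mc → P.ps.IsMeet p d md → P.ps.IsMeet p cd mcd →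
        (P.intervalStruct p).IsJoin ⟨mc, hmc⟩ ⟨md, hmd⟩ ⟨mcd, hmcd⟩) ∧
     (∀ c cs mc mcs, P.ps.IsCentral c → P.ps.padd c cs = some P.ps.one →
        P.ps.IsMeet p c mc → P.ps.IsMeet p cs mcs →
        P.ps.padd mc mcs = some p)) := by
  refine ⟨?_, ?_, ?_, ?_, ?_, ?_⟩
  · intro c hc
    obtain ⟨cs, f, D⟩ := P.exists_isCentralDecomp hc
    exact ⟨_, D.fst_le_self p, D.isMeet_fst p, D.isCentral_interval p⟩
  · exact fun m hm => P.eq_zero_of_le_zero hm.2.1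
  · exact fun m hm => P.le_antisymm hm.1 (hm.2.2 p (P.le_refl p) (P.le_one p))
  · intro c d cd mc md mcd hmc hmd hmcd _ _ hcd hc hd h
    simp only [IsMeet, PEA.intervalStruct_le]
    refine ⟨hc.2.2 _ h.1 (P.le_trans h.2.1 hcd.1), hd.2.2 _ h.1 (P.le_trans h.2.1 hcd.2.1),
      fun x hxc hxd => h.2.2 _ x.2 (hcd.2.2 _ ?_ ?_)⟩
    · exact P.le_trans hxc hc.2.1
    · exact P.le_trans hxd hd.2.1
  · intro c d cd mc md mcd hmc hmd hmcd hcen _ hcd hc hd h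
    obtain ⟨cs, f, D⟩ := P.exists_isCentralDecomp hcen
    have hJ := D.isJoin_meet hcd hc hd h
    simp only [IsJoin, PEA.intervalStruct_le]
    exact ⟨hJ.1, hJ.2.1, fun x => hJ.2.2 x.1⟩
  · intro c cs mc mcs hcen hcs hc hd
    obtain ⟨cs', f, D⟩ := P.exists_isCentralDecomp hcen
    obtain rfl := P.padd_left_cancel hcs D.compl
    obtain rfl := P.isMeet_unique hc (D.isMeet_fst p)
    obtain rfl := P.isMeet_unique hd (D.isMeet_snd p)
    exact D.add_eq p
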